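/- Every cyclic word in letters a, b yields by elementary cancellations a unique economical word: if w is a cyclic word in letters a, b and u, v are economical cyclic words each obtainable from w by a finite sequence of elementary cancellations, then u = v as cyclic words (i.e., u is a cyclic rotation of v). -/

import Mathlib

/-- The two-letter alphabet `{a, b}`. -/
inductive AB : Type
  | a : AB
  | b : AB
deriving DecidableEq

/-- Equality of words up to cyclic rotation (equality as cyclic words). -/
def CycEq {α : Type*} (w₁ w₂ : List α) : Prop := ∃ n : ℕ, w₂ = w₁.rotate n

/-- The letter at the position cyclically following `i`. -/
def cnext {α : Type*} (w : List α) (i : Fin w.length) : α :=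
  w.get ⟨(i.1 + 1) % w.length, Nat.mod_lt _ (Nat.lt_of_le_of_lt (Nat.zero_le _) i.isLt)⟩

/-- Elementary cancellation of a cyclic word in letters `a`, `b`: deletion of two
cyclically adjacent equal letters. -/
def CancelW (w w' : List AB) : Prop :=
  ∃ (x : AB) (rest : List AB), CycEq w (x :: x :: rest) ∧ CycEq w' rest

/-- A cyclic word is economical if no two cyclically adjacent positions carry
equal letters (words of length at most 1 are economical). -/
def EconomicalW (w : List AB) : Prop :=
  2 ≤ w.length → ∀ i : Fin w.length, w.get i ≠ cnext w i


def AB.fl : AB → AB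
  | .a => .b
  | .b => .a

def AB.val : AB → ℤ
  | .a => 1
  | .b => 0

def altS : List AB → ℤ
  | [] => 0
  | x :: t => x.val - altS t

def altW : AB → ℕ → List AB
  | _, 0 => []
  | x, n + 1 => x :: altW x.fl n

/-- The invariant: two words are related. -/
def WInv (u v : List AB) : Prop :=
  u.length % 2 = v.length % 2 ∧
    (u.length % 2 = 0 → (altS u).natAbs = (altS v).natAbs) ∧
    (u.length % 2 = 1 → altS u % 2 = altS v % 2)

theorem WInv.rfl' (u : List AB) : WInv u u := ⟨rfl, fun _ => rfl, fun _ => rfl⟩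

theorem WInv.symm' {u v : List AB} (h : WInv u v) : WInv v u := by
  obtain ⟨h1, h2, h3⟩ := h
  exact ⟨h1.symm, fun h => (h2 (by omega)).symm, fun h => (h3 (by omega)).symm⟩

theorem WInv.trans' {u v w : List AB} (h : WInv u v) (k : WInv v w) : WInv u w := by
  obtain ⟨h1, h2, h3⟩ := h
  obtain ⟨k1, k2, k3⟩ := k
  exact ⟨h1.trans k1, fun h => (h2 h).trans (k2 (by omega)),
    fun h => (h3 h).trans (k3 (by omega))⟩

theorem altS_snoc (t : List AB) (x : AB) :
    altS (t ++ [x]) = if t.length % 2 = 0 then altS t + x.val else altS t - x.val := by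
  induction t with
  | nil => simp [altS]
  | cons y t ih =>
    simp only [List.cons_append, altS, ih, List.length_cons]
    split_ifs <;> omega

theorem inv_rotate (w : List AB) (n : ℕ) : WInv w (w.rotate n) := by
  induction n generalizing w with
  | zero => simpa using WInv.rfl' w
  | succ n ih =>
    cases w with
    | nil => simpa using WInv.rfl' []
    | cons x t =>
      rw [List.rotate_cons_succ]
      refine WInv.trans' ?_ (ih _)
      refine ⟨by simp, ?_, ?_⟩ <;>
      · simp only [List.length_cons, altS_snoc, altS]
        intro h
        split_ifs <;> omega

theorem inv_cyc {u v : List AB} (h : CycEq u v) : WInv u v := by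
  obtain ⟨n, rfl⟩ := h
  exact inv_rotate u n

theorem inv_cancel {u v : List AB} (h : CancelW u v) : WInv u v := by
  obtain ⟨x, r, h1, h2⟩ := h
  refine (inv_cyc h1).trans' (WInv.trans' ?_ (inv_cyc h2).symm')
  refine ⟨by simp only [List.length_cons]; omega, ?_, ?_⟩ <;> simp [altS]

theorem inv_star {u v : List AB} (h : Relation.ReflTransGen CancelW u v) : WInv u v := by
  induction h with
  | refl => exact WInv.rfl' _
  | tail _ h ih => exact ih.trans' (inv_cancel h)

theorem altW_length (x : AB) (n : ℕ) : (altW x n).length = n := by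
  induction n generalizing x with
  | zero => rfl
  | succ n ih => simp [altW, ih]

theorem altW_S (x : AB) (n : ℕ) :
    altS (altW x n) = match x with
      | .a => (((n + 1) / 2 : ℕ) : ℤ)
      | .b => -((n / 2 : ℕ) : ℤ) := by
  induction n generalizing x with
  | zero => cases x <;> simp [altW, altS]
  | succ n ih => cases x <;> simp only [altW, altS, ih, AB.fl, AB.val] <;> omega

theorem AB.fl_fl (x : AB) : x.fl.fl = x := by cases x <;> rfl

theorem altW_snoc (x : AB) (n : ℕ) :
    altW x (n + 1) = altW x n ++ [if n % 2 = 0 then x else x.fl] := by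
  induction n generalizing x with
  | zero => rfl
  | succ n ih =>
    rw [altW, ih, altW]
    simp only [List.cons_append, AB.fl_fl]
    congr 3
    split_ifs <;> first | rfl | omega

theorem altW_of_chain (x : AB) (t : List AB) (h : (x :: t).IsChain (· ≠ ·)) :
    x :: t = altW x (t.length + 1) := by
  induction t generalizing x with
  | nil => rfl
  | cons y t ih =>
    rw [List.isChain_cons_cons] at h
    have : y = x.fl := by
      have := h.1
      cases x <;> cases y <;> simp_all [AB.fl]
    rw [ih y h.2, this, altW_length]; rfl

theorem econ_form (u : List AB) (h : EconomicalW u) :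
    ∃ x n, u = altW x n ∧ (n % 2 = 1 → n = 1) := by
  rcases u with _ | ⟨x, t⟩
  · exact ⟨.a, 0, rfl, by simp⟩
  rcases t with _ | ⟨y, t⟩
  · exact ⟨x, 1, rfl, by simp⟩
  have h := h (by simp)
  have hc : (x :: y :: t).IsChain (· ≠ ·) := by
    rw [List.isChain_iff_getElem]
    intro i hi
    have := h ⟨i, by omega⟩
    simpa only [cnext, List.get_eq_getElem, Nat.mod_eq_of_lt hi] using this
  have he := altW_of_chain _ _ hc
  refine ⟨x, _, he, ?_⟩
  intro ho
  exfalso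
  have hl := h ⟨t.length + 1, by simp⟩
  simp only [cnext, List.get_eq_getElem, List.length_cons, Nat.mod_self,
    List.getElem_cons_zero] at hl
  apply hl
  have h2 : (x :: y :: t)[t.length + 1]? = some x := by
    rw [he, altW_snoc, List.getElem?_append_right (by simp [altW_length])]
    simp only [List.length_cons] at ho ⊢
    simp only [altW_length]
    rw [if_pos (by omega)]
    simp
  rw [List.getElem?_eq_getElem (by simp)] at h2
  exact Option.some.inj h2

theorem altW_rot (x : AB) (n : ℕ) (h : n % 2 = 0) : (altW x n).rotate 1 = altW x.fl n := by
  cases n with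
  | zero => rfl
  | succ n =>
    rw [altW_snoc x.fl, altW, List.rotate_cons_succ, List.rotate_zero, if_neg (by omega),
      AB.fl_fl]

/-- a cyclic word in letters `a`, `b` yields by elementary
cancellations a unique economical word (unique as a cyclic word). -/
theorem economical_form_unique (w u v : List AB)
    (hu : Relation.ReflTransGen CancelW w u) (hv : Relation.ReflTransGen CancelW w v)
    (heu : EconomicalW u) (hev : EconomicalW v) : CycEq u v := by
  have hI := (inv_star hu).symm'.trans' (inv_star hv)
  obtain ⟨x, n, rfl, hn⟩ := econ_form u heu
  obtain ⟨y, m, rfl, hm⟩ := econ_form v hev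
  obtain ⟨h1, h2, h3⟩ := hI
  simp only [altW_length, altW_S] at h1 h2 h3
  rcases Nat.mod_two_eq_zero_or_one n with h | h
  · have h2 := h2 h
    have hnm : n = m := by
      cases x <;> cases y <;> simp only at h2 <;> omega
    subst hnm
    by_cases hxy : x = y
    · exact ⟨0, by simp [hxy]⟩
    · refine ⟨1, ?_⟩
      rw [altW_rot x n h]
      cases x <;> cases y <;> simp_all [AB.fl]
  · have h3 := h3 h
    obtain rfl := hn h
    obtain rfl := hm (by omega)
    cases x <;> cases y <;> first | exact ⟨0, rfl⟩ | (exfalso; revert h3; decide)
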